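/- Fix an integer n ≥ 1 and consider the partitions λ ⊆ ℕ^{3n−1} with embedding dimension h_λ(1) = 3n−1 whose socle consists of exactly n elements, all of degree 3. Every such λ has Hilbert–Samuel function (1, 3n−1, 3n, n) or (1, 3n−1, 3n−1, n) (i.e. h_λ(0)=1, h_λ(1)=3n−1, h_λ(2) ∈ {3n, 3n−1}, h_λ(3)=n and h_λ(i)=0 for i>3). The number N₁ of such partitions with h_λ(2) = 3n satisfies 2·N₁ = 3(n−1)·(3n)!/(6^n·n!), and the number of such partitions with h_λ(2) = 3n−1 equals 2·(3n)!/(6^n·n!). -/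

import Mathlib

open Finset

attribute [local instance] Classical.propDecidable

noncomputable section

/-- A finite downward-closed subset of `ℕ^n` (an `(n-1)`-dimensional partition). -/
def IsPartitionFn {n : ℕ} (lam : Finset (Fin n → ℕ)) : Prop :=
  ∀ a ∈ lam, ∀ y : Fin n → ℕ, y ≤ a → y ∈ lam

/-- Degree of a lattice point. -/
def degFn {n : ℕ} (y : Fin n → ℕ) : ℕ := ∑ i, y i

/-- Hilbert–Samuel function. -/
def hsFn {n : ℕ} (lam : Finset (Fin n → ℕ)) (k : ℕ) : ℕ :=
  (lam.filter fun a => degFn a = k).card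

/-- Socle: maximal elements. -/
def socleFn {n : ℕ} (lam : Finset (Fin n → ℕ)) : Finset (Fin n → ℕ) :=
  lam.filter fun a => ∀ b ∈ lam, ¬ a < b

/-- Number of `(n-1)`-dimensional partitions of size `d`. -/
def pNum (d n : ℕ) : ℕ :=
  Set.ncard {lam : Finset (Fin n → ℕ) | IsPartitionFn lam ∧ lam.card = d}

/-- Number of `(k-1)`-dimensional partitions of size `d` and embedding dimension `k`. -/
def yNum (d k : ℕ) : ℕ :=
  Set.ncard {lam : Finset (Fin k → ℕ) | IsPartitionFn lam ∧ lam.card = d ∧ hsFn lam 1 = k}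

/-- Number of `(k-1)`-dimensional partitions of size `1+k+e`, embedding dimension `k`,
and socle in degree `≥ 2`. -/
def cNum (e k : ℕ) : ℕ :=
  Set.ncard {lam : Finset (Fin k → ℕ) | IsPartitionFn lam ∧ lam.card = 1 + k + e ∧
    hsFn lam 1 = k ∧ ∀ a ∈ socleFn lam, 2 ≤ degFn a}

end


/-! ### Helpers -/

lemma degFn_add' {N : ℕ} (a b : Fin N → ℕ) : degFn (a + b) = degFn a + degFn b := by
  simp [degFn, Finset.sum_add_distrib]

lemma degFn_single' {N : ℕ} (i : Fin N) (c : ℕ) : degFn (Pi.single i c) = c := by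
  simp [degFn]

lemma degFn_mono' {N : ℕ} {a b : Fin N → ℕ} (h : a ≤ b) : degFn a ≤ degFn b :=
  Finset.sum_le_sum fun i _ => h i

lemma eq_of_le_deg {N : ℕ} {a b : Fin N → ℕ} (h : a ≤ b) (hd : degFn b ≤ degFn a) : a = b := by
  have h1 : degFn a = degFn b := le_antisymm (degFn_mono' h) hd
  funext i
  exact (Finset.sum_eq_sum_iff_of_le (fun i _ => h i)).1 h1 i (Finset.mem_univ i)

lemma exists_split {N m : ℕ} {a : Fin N → ℕ} (h : degFn a = m + 1) :
    ∃ i b, a = Pi.single i 1 + b ∧ degFn b = m := by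
  have : ∃ i, a i ≠ 0 := by
    by_contra! hc
    simp [degFn, hc] at h
  obtain ⟨i, hi⟩ := this
  have hle : Pi.single i 1 ≤ a := by
    intro x
    by_cases hx : x = i
    · subst hx; simp; omega
    · simp [hx]
  refine ⟨i, a - Pi.single i 1, (add_tsub_cancel_of_le hle).symm, ?_⟩
  have h2 := degFn_add' (Pi.single i 1) (a - Pi.single i 1)
  rw [add_tsub_cancel_of_le hle, degFn_single', h] at h2
  omega

lemma deg_zero' {N : ℕ} {a : Fin N → ℕ} (h : degFn a = 0) : a = 0 := by
  funext i
  simp [degFn] at h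
  simp [h i]

lemma deg_one' {N : ℕ} {a : Fin N → ℕ} (h : degFn a = 1) : ∃ i, a = Pi.single i 1 := by
  obtain ⟨i, b, hb, h0⟩ := exists_split h
  exact ⟨i, by rw [hb, deg_zero' h0, add_zero]⟩

/-- The monomial of a word. -/
def monW {N : ℕ} (w : Fin 3 → Fin N) : Fin N → ℕ := ∑ j, Pi.single (w j) 1

lemma monW_eq {N : ℕ} (w : Fin 3 → Fin N) :
    monW w = Pi.single (w 0) 1 + Pi.single (w 1) 1 + Pi.single (w 2) 1 := by
  simp [monW, Fin.sum_univ_three]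

lemma monW_apply {N : ℕ} (w : Fin 3 → Fin N) (x : Fin N) :
    monW w x = (if w 0 = x then 1 else 0) + (if w 1 = x then 1 else 0)
      + (if w 2 = x then 1 else 0) := by
  simp [monW_eq, Pi.single_apply, eq_comm]

lemma deg_monW {N : ℕ} (w : Fin 3 → Fin N) : degFn (monW w) = 3 := by
  simp [monW_eq, degFn_add', degFn_single']

lemma monW_ne_zero {N : ℕ} (w : Fin 3 → Fin N) (x : Fin N) : monW w x ≠ 0 ↔ ∃ j, w j = x := by
  rw [monW_apply, Fin.exists_fin_succ, Fin.exists_fin_succ, Fin.exists_fin_succ]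
  simp
  tauto

lemma monW_le_one {N : ℕ} (w : Fin 3 → Fin N) :
    (∀ x, monW w x ≤ 1) ↔ Function.Injective w := by
  constructor
  · intro h i j hij
    have h0 := h (w i)
    rw [monW_apply] at h0
    fin_cases i <;> fin_cases j <;> simp_all <;> grind
  · intro h x
    have h01 : w 0 ≠ w 1 := fun e => by simpa using h e
    have h02 : w 0 ≠ w 2 := fun e => by simpa using h e
    have h12 : w 1 ≠ w 2 := fun e => by simpa using h e
    rw [monW_apply]
    grind

lemma exists_word {N : ℕ} {a : Fin N → ℕ} (h : degFn a = 3) : ∃ w, monW w = a := by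
  obtain ⟨i, b, hb, h0⟩ := exists_split h
  obtain ⟨j, c, hc, h0⟩ := exists_split h0
  obtain ⟨k, rfl⟩ := deg_one' h0
  exact ⟨![i, j, k], by rw [monW_eq, hb, hc]; simp [add_assoc]⟩

lemma word_ext {N : ℕ} (w : Fin 3 → Fin N) {x y z : Fin N} :
    w = ![x, y, z] ↔ w 0 = x ∧ w 1 = y ∧ w 2 = z := by
  constructor
  · rintro rfl; simp
  · rintro ⟨rfl, rfl, rfl⟩
    funext t; fin_cases t <;> rfl

/-- Words of a given monomial. -/
def wordsOf {N : ℕ} (a : Fin N → ℕ) : Finset (Fin 3 → Fin N) :=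
  Finset.univ.filter fun w => monW w = a

lemma card_words_sq {N : ℕ} {a : Fin N → ℕ} (h : degFn a = 3) (h1 : ∀ x, a x ≤ 1) :
    (wordsOf a).card = 6 := by
  obtain ⟨w, rfl⟩ := exists_word h
  rw [monW_le_one] at h1
  have h01 : w 0 ≠ w 1 := fun e => by simpa using h1 e
  have h02 : w 0 ≠ w 2 := fun e => by simpa using h1 e
  have h12 : w 1 ≠ w 2 := fun e => by simpa using h1 e
  generalize hi : w 0 = i at *
  generalize hj : w 1 = j at *
  generalize hk : w 2 = k at *
  have : wordsOf (monW w) = {![i,j,k], ![i,k,j], ![j,i,k], ![j,k,i], ![k,i,j], ![k,j,i]} := by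
    ext v
    simp only [wordsOf, Finset.mem_filter, Finset.mem_univ, true_and, Finset.mem_insert,
      Finset.mem_singleton, word_ext]
    constructor
    · intro e
      have e1 := congrFun e i
      have e2 := congrFun e j
      have e3 := congrFun e k
      rw [monW_apply, monW_apply, hi, hj, hk] at e1 e2 e3
      grind
    · intro e
      funext x
      rw [monW_apply, monW_apply, hi, hj, hk]
      rcases e with ⟨e1, e2, e3⟩ | ⟨e1, e2, e3⟩ | ⟨e1, e2, e3⟩ | ⟨e1, e2, e3⟩ | ⟨e1, e2, e3⟩ |
        ⟨e1, e2, e3⟩ <;> rw [e1, e2, e3] <;> omega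
  rw [this]
  have := h01.symm
  have := h02.symm
  have := h12.symm
  repeat rw [Finset.card_insert_of_notMem (by simp [*])]
  simp

lemma card_words_dbl {N : ℕ} {i j : Fin N} (hij : i ≠ j) :
    (wordsOf (Pi.single i 2 + Pi.single j 1)).card = 3 := by
  have : wordsOf (Pi.single i 2 + Pi.single j 1) = {![i,i,j], ![i,j,i], ![j,i,i]} := by
    ext v
    simp only [wordsOf, Finset.mem_filter, Finset.mem_univ, true_and, Finset.mem_insert,
      Finset.mem_singleton, word_ext]
    constructor
    · intro e
      have e1 := congrFun e i
      have e2 := congrFun e j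
      rw [monW_apply] at e1 e2
      simp only [Pi.add_apply, Pi.single_apply] at e1 e2
      grind
    · intro e
      funext x
      rw [monW_apply]
      simp only [Pi.add_apply, Pi.single_apply]
      grind
  rw [this]
  have := hij.symm
  repeat rw [Finset.card_insert_of_notMem (by simp [*])]
  simp

/-- Degree two divisors. -/
def divTwo {N : ℕ} (a : Fin N → ℕ) : Finset (Fin N → ℕ) :=
  (Finset.Iic a).filter fun b => degFn b = 2

lemma card_divTwo {N : ℕ} {a : Fin N → ℕ} (h : degFn a = 3) :
    (divTwo a).card = (Finset.univ.filter fun i => a i ≠ 0).card := by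
  symm
  have key : ∀ i, a i ≠ 0 → Pi.single i 1 ≤ a := by
    intro i hi x
    by_cases hx : x = i
    · subst hx; simp; omega
    · simp [hx]
  refine Finset.card_bij (fun i _ => a - Pi.single i 1) ?_ ?_ ?_
  · intro i hi
    have hi' : a i ≠ 0 := by simpa using hi
    have h2 := degFn_add' (Pi.single i 1) (a - Pi.single i 1)
    rw [add_tsub_cancel_of_le (key i hi'), degFn_single', h] at h2
    simp only [divTwo, Finset.mem_filter, Finset.mem_Iic]
    exact ⟨tsub_le_self, by omega⟩
  · intro i hi j hj e
    have hi' : a i ≠ 0 := by simpa using hi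
    have e1 := congrFun e i
    by_contra hne
    simp [hne] at e1
    omega
  · intro b hb
    simp only [divTwo, Finset.mem_filter, Finset.mem_Iic] at hb
    obtain ⟨hb, hd⟩ := hb
    have h2 := degFn_add' b (a - b)
    rw [add_tsub_cancel_of_le hb, hd, h] at h2
    obtain ⟨i, hi⟩ := deg_one' (a := a - b) (by omega)
    have h3 : a = b + Pi.single i 1 := by rw [← hi, add_tsub_cancel_of_le hb]
    refine ⟨i, by simp [h3], ?_⟩
    rw [h3, add_tsub_cancel_right]

lemma card_div_sq {N : ℕ} {a : Fin N → ℕ} (h : degFn a = 3) (h1 : ∀ x, a x ≤ 1) :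
    (divTwo a).card = 3 := by
  rw [card_divTwo h, Finset.card_filter, ← h, degFn]
  refine Finset.sum_congr rfl fun i _ => ?_
  have := h1 i
  split_ifs <;> omega

lemma card_div_dbl {N : ℕ} {i j : Fin N} (hij : i ≠ j) :
    (divTwo (Pi.single i 2 + Pi.single j 1)).card = 2 := by
  rw [card_divTwo (by simp [degFn_add', degFn_single'])]
  have : (Finset.univ.filter fun x => (Pi.single i 2 + Pi.single j 1 : Fin N → ℕ) x ≠ 0)
      = {i, j} := by
    ext x
    simp [Pi.single_apply]
    tauto
  rw [this, Finset.card_pair hij]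

lemma excess_lemma {N n : ℕ} (hN : N + 1 = 3 * n) {ι : Type*} (s : Finset ι)
    (m : ι → Fin N → ℕ) (hs : s.card = n) (hd : ∀ k ∈ s, degFn (m k) = 3)
    (d : Fin N → ℕ) (h : ∀ i, d i + 1 ≤ ∑ k ∈ s, m k i) : degFn d ≤ 1 := by
  have h1 : ∑ i, (d i + 1) ≤ ∑ i, ∑ k ∈ s, m k i := Finset.sum_le_sum fun i _ => h i
  rw [Finset.sum_comm, Finset.sum_add_distrib] at h1
  have h2 : ∑ k ∈ s, ∑ i, m k i = n * 3 := by
    rw [← hs]; exact Finset.sum_const_nat hd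
  rw [h2] at h1
  simp at h1
  unfold degFn
  omega

/-- Covering sets of cubic monomials. -/
def CovS {N : ℕ} (n : ℕ) (S : Finset (Fin N → ℕ)) : Prop :=
  S.card = n ∧ (∀ a ∈ S, degFn a = 3) ∧ ∀ i, ∃ a ∈ S, a i ≠ 0

/-- Squarefree sets. -/
def SqS {N : ℕ} (S : Finset (Fin N → ℕ)) : Prop := ∀ a ∈ S, ∀ i, a i ≤ 1

lemma sum_pair_le {ι : Type*} {s : Finset ι} (f : ι → ℕ) {a b : ι} (ha : a ∈ s) (hb : b ∈ s)
    (hab : a ≠ b) : f a + f b ≤ ∑ k ∈ s, f k := by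
  rw [← Finset.sum_pair hab]
  exact Finset.sum_le_sum_of_subset (by
    intro x hx
    simp at hx
    rcases hx with rfl | rfl <;> assumption)

lemma CovS.pos {N n : ℕ} {S : Finset (Fin N → ℕ)} (h : CovS n S) (i : Fin N) :
    1 ≤ ∑ a ∈ S, a i := by
  obtain ⟨a, ha, hi⟩ := h.2.2 i
  have := Finset.single_le_sum (f := fun a : Fin N → ℕ => a i) (fun _ _ => Nat.zero_le _) ha
  omega

lemma CovS.divTwo_card {N n : ℕ} (hN : N + 1 = 3 * n) {S : Finset (Fin N → ℕ)} (h : CovS n S) :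
    (S.biUnion divTwo).card = ∑ a ∈ S, (divTwo a).card := by
  apply Finset.card_biUnion
  intro a ha a' ha' hne
  rw [Function.onFun, Finset.disjoint_left]
  intro b hb hb'
  simp only [divTwo, Finset.mem_filter, Finset.mem_Iic] at hb hb'
  have := excess_lemma hN S (fun a => a) h.1 h.2.1 b (by
    intro i
    have h1 := sum_pair_le (fun a : Fin N → ℕ => a i) ha ha' hne
    have h2 := h.pos i
    have h3 : b i ≤ a i := hb.1 i
    have h4 : b i ≤ a' i := hb'.1 i
    omega)
  omega

lemma CovS.sq_card {N n : ℕ} (hN : N + 1 = 3 * n) {S : Finset (Fin N → ℕ)} (h : CovS n S)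
    (hq : SqS S) : (S.biUnion divTwo).card = 3 * n ∧ ∏ a ∈ S, (wordsOf a).card = 6 ^ n := by
  rw [h.divTwo_card hN]
  constructor
  · rw [Finset.sum_const_nat (m := 3) fun a ha => card_div_sq (h.2.1 a ha) (hq a ha), h.1, mul_comm]
  · rw [Finset.prod_congr rfl fun a ha => card_words_sq (h.2.1 a ha) (hq a ha), Finset.prod_const,
      h.1]

lemma CovS.nsq_card {N n : ℕ} (hN : N + 1 = 3 * n) {S : Finset (Fin N → ℕ)} (h : CovS n S)
    (hq : ¬ SqS S) : (S.biUnion divTwo).card = 3 * n - 1 ∧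
      2 * ∏ a ∈ S, (wordsOf a).card = 6 ^ n := by
  rw [h.divTwo_card hN]
  simp only [SqS, not_forall, not_le] at hq
  obtain ⟨a, ha, i, hi⟩ := hq
  have hother : ∀ b ∈ S.erase a, ∀ j, b j ≤ 1 := by
    intro b hb j
    by_contra! hj
    rw [Finset.mem_erase] at hb
    have := excess_lemma hN S (fun a => a) h.1 h.2.1 (Pi.single i 1 + Pi.single j 1) (by
      intro x
      have h1 := sum_pair_le (fun a : Fin N → ℕ => a x) hb.2 ha hb.1
      have h2 := h.pos x
      simp only [Pi.add_apply, Pi.single_apply] at h1 ⊢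
      split_ifs <;> subst_vars <;> omega)
    simp [degFn_add', degFn_single'] at this
  have hle : ∀ x, a x ≤ ∑ b ∈ S, b x := fun x =>
    Finset.single_le_sum (f := fun a : Fin N → ℕ => a x) (fun _ _ => Nat.zero_le _) ha
  have ha3 : a i < 3 := by
    by_contra! hj
    have := excess_lemma hN S (fun a => a) h.1 h.2.1 (Pi.single i 2) (by
      intro x
      have h1 := hle x
      have h2 := h.pos x
      simp only [Pi.single_apply] at h1 ⊢
      split_ifs <;> subst_vars <;> omega)
    simp [degFn_single'] at this
  have hsl : Pi.single i 2 ≤ a := by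
    intro x
    by_cases hx : x = i
    · subst hx; simp; omega
    · simp [hx]
  have h2 := degFn_add' (Pi.single i 2) (a - Pi.single i 2)
  rw [add_tsub_cancel_of_le hsl, degFn_single', h.2.1 a ha] at h2
  obtain ⟨j, hj⟩ := deg_one' (a := a - Pi.single i 2) (by omega)
  have haeq : a = Pi.single i 2 + Pi.single j 1 := by rw [← hj, add_tsub_cancel_of_le hsl]
  have hij : i ≠ j := by
    rintro rfl
    rw [haeq] at ha3
    simp at ha3
  have hc : (S.erase a).card + 1 = n := by rw [Finset.card_erase_add_one ha, h.1]
  have hd : ∀ b ∈ S.erase a, degFn b = 3 := fun b hb => h.2.1 b (Finset.mem_of_mem_erase hb)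
  constructor
  · rw [← Finset.add_sum_erase S _ ha,
      Finset.sum_const_nat (m := 3) fun a ha => card_div_sq (hd a ha) (hother a ha), haeq,
      card_div_dbl hij, ← haeq]
    omega
  · rw [← Finset.mul_prod_erase S _ ha,
      Finset.prod_congr rfl fun a ha => card_words_sq (hd a ha) (hother a ha), Finset.prod_const,
      haeq, card_words_dbl hij, ← haeq, ← hc, pow_succ]
    ring

/-! ### Partitions and socles -/

lemma mem_iff_socle {N : ℕ} {lam : Finset (Fin N → ℕ)} (h : IsPartitionFn lam) (b : Fin N → ℕ) :
    b ∈ lam ↔ ∃ a ∈ socleFn lam, b ≤ a := by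
  constructor
  · intro hb
    obtain ⟨a, hba, ha⟩ := Finset.exists_le_maximal lam hb
    refine ⟨a, ?_, hba⟩
    simp only [socleFn, Finset.mem_filter]
    exact ⟨ha.prop, fun c hc hac => ha.not_gt hc hac⟩
  · rintro ⟨a, ha, hba⟩
    exact h a (Finset.mem_filter.1 ha).1 b hba

/-- The lower closure. -/
def genS {N : ℕ} (S : Finset (Fin N → ℕ)) : Finset (Fin N → ℕ) := S.biUnion fun a => Finset.Iic a

lemma mem_genS {N : ℕ} {S : Finset (Fin N → ℕ)} {b : Fin N → ℕ} :
    b ∈ genS S ↔ ∃ a ∈ S, b ≤ a := by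
  simp [genS]

lemma genS_part {N : ℕ} (S : Finset (Fin N → ℕ)) : IsPartitionFn (genS S) := by
  intro a ha y hy
  rw [mem_genS] at *
  obtain ⟨c, hc, h⟩ := ha
  exact ⟨c, hc, hy.trans h⟩

lemma genS_socle {N : ℕ} {lam : Finset (Fin N → ℕ)} (h : IsPartitionFn lam) :
    genS (socleFn lam) = lam := by
  ext b
  rw [mem_genS, mem_iff_socle h]

lemma socle_genS {N k : ℕ} {S : Finset (Fin N → ℕ)} (h : ∀ a ∈ S, degFn a = k) :
    socleFn (genS S) = S := by
  ext b
  simp only [socleFn, Finset.mem_filter, mem_genS]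
  constructor
  · rintro ⟨⟨a, ha, hba⟩, hm⟩
    rcases hba.eq_or_lt with rfl | hlt
    · exact ha
    · exact absurd hlt (hm a ⟨a, ha, le_rfl⟩)
  · intro hb
    refine ⟨⟨b, hb, le_rfl⟩, ?_⟩
    rintro c ⟨a, ha, hca⟩ hbc
    have h1 : b = a := eq_of_le_deg (hbc.le.trans hca) (by rw [h a ha, h b hb])
    subst h1
    exact absurd hbc (not_lt_of_ge hca)

lemma hs_one {N : ℕ} {lam : Finset (Fin N → ℕ)} :
    hsFn lam 1 = N ↔ ∀ i, Pi.single i 1 ∈ lam := by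
  have himg : (Finset.univ.image fun i : Fin N => (Pi.single i 1 : Fin N → ℕ)).card = N := by
    rw [Finset.card_image_of_injective]
    · simp
    · intro i j e
      by_contra hne
      have := congrFun e i
      simp [hne] at this
  have hsub : (lam.filter fun a => degFn a = 1) ⊆
      Finset.univ.image fun i : Fin N => (Pi.single i 1 : Fin N → ℕ) := by
    intro a ha
    obtain ⟨i, rfl⟩ := deg_one' (Finset.mem_filter.1 ha).2
    simp
  constructor
  · intro h i
    have := Finset.eq_of_subset_of_card_le hsub (by rw [himg]; exact h.ge)
    have h2 : (Pi.single i 1 : Fin N → ℕ) ∈ lam.filter fun a => degFn a = 1 := by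
      rw [this]; simp
    exact (Finset.mem_filter.1 h2).1
  · intro h
    have : (lam.filter fun a => degFn a = 1) =
      Finset.univ.image fun i : Fin N => (Pi.single i 1 : Fin N → ℕ) := by
      apply hsub.antisymm
      intro a ha
      simp only [Finset.mem_image, Finset.mem_univ, true_and] at ha
      obtain ⟨i, rfl⟩ := ha
      simp [h i, degFn_single']
    rw [hsFn, this, himg]

lemma single_le_iff' {N : ℕ} {i : Fin N} {a : Fin N → ℕ} : Pi.single i 1 ≤ a ↔ a i ≠ 0 := by
  constructor
  · intro h
    have := h i
    simp at this
    omega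
  · intro hi x
    by_cases hx : x = i
    · subst hx; simp; omega
    · simp [hx]

lemma hs_two {N : ℕ} (S : Finset (Fin N → ℕ)) : hsFn (genS S) 2 = (S.biUnion divTwo).card := by
  unfold hsFn
  congr 1
  ext b
  simp only [Finset.mem_filter, mem_genS, Finset.mem_biUnion, divTwo, Finset.mem_Iic]
  grind

lemma good_iff {N n : ℕ} {lam : Finset (Fin N → ℕ)} (h : IsPartitionFn lam) :
    CovS n (socleFn lam) ↔ hsFn lam 1 = N ∧ (socleFn lam).card = n ∧
      ∀ a ∈ socleFn lam, degFn a = 3 := by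
  rw [hs_one]
  have : (∀ i, Pi.single i 1 ∈ lam) ↔ ∀ i, ∃ a ∈ socleFn lam, a i ≠ 0 := by
    simp only [mem_iff_socle h, single_le_iff']
  rw [this, CovS]
  tauto

lemma good_hs {N n : ℕ} (hN : N + 1 = 3 * n) {lam : Finset (Fin N → ℕ)} (h : IsPartitionFn lam)
    (hc : CovS n (socleFn lam)) :
    hsFn lam 0 = 1 ∧ hsFn lam 2 = (if SqS (socleFn lam) then 3 * n else 3 * n - 1) ∧
      hsFn lam 3 = n ∧ ∀ i, 3 < i → hsFn lam i = 0 := by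
  have hle : ∀ b ∈ lam, ∃ a ∈ socleFn lam, b ≤ a ∧ degFn a = 3 := by
    intro b hb
    obtain ⟨a, ha, hba⟩ := (mem_iff_socle h b).1 hb
    exact ⟨a, ha, hba, hc.2.1 a ha⟩
  refine ⟨?_, ?_, ?_, ?_⟩
  · have hne : (socleFn lam).Nonempty := by
      rw [← Finset.card_pos, hc.1]; omega
    obtain ⟨a, ha⟩ := hne
    have h0 : (0 : Fin N → ℕ) ∈ lam := (mem_iff_socle h 0).2 ⟨a, ha, fun i => Nat.zero_le _⟩
    rw [hsFn, Finset.card_eq_one]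
    refine ⟨0, ?_⟩
    ext b
    simp only [Finset.mem_filter, Finset.mem_singleton]
    constructor
    · rintro ⟨_, hb⟩; exact deg_zero' hb
    · rintro rfl; exact ⟨h0, by simp [degFn]⟩
  · have h2 := hs_two (socleFn lam)
    rw [genS_socle h] at h2
    rw [h2]
    split_ifs with hq
    · exact (hc.sq_card hN hq).1
    · exact (hc.nsq_card hN hq).1
  · rw [hsFn, ← hc.1]
    congr 1
    ext b
    simp only [Finset.mem_filter]
    constructor
    · rintro ⟨hb, hd⟩
      obtain ⟨a, ha, hba, hd'⟩ := hle b hb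
      rwa [eq_of_le_deg hba (by omega)]
    · intro hb
      exact ⟨(Finset.mem_filter.1 hb).1, hc.2.1 b hb⟩
  · intro i hi
    rw [hsFn, Finset.card_eq_zero, Finset.filter_eq_empty_iff]
    intro b hb hd
    obtain ⟨a, ha, hba, hd'⟩ := hle b hb
    have := degFn_mono' hba
    omega

lemma ncard_eq {N n : ℕ} (P : Finset (Fin N → ℕ) → Prop) :
    Set.ncard {lam : Finset (Fin N → ℕ) | IsPartitionFn lam ∧ CovS n (socleFn lam) ∧
      P (socleFn lam)} = Set.ncard {S : Finset (Fin N → ℕ) | CovS n S ∧ P S} := by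
  refine Set.ncard_congr (fun lam _ => socleFn lam) ?_ ?_ ?_
  · rintro lam ⟨_, h⟩
    exact h
  · rintro a b ⟨ha, _⟩ ⟨hb, _⟩ e
    rw [← genS_socle ha, e, genS_socle hb]
  · rintro S ⟨hS, hP⟩
    have := socle_genS hS.2.1
    exact ⟨genS S, ⟨genS_part S, by rw [this]; exact hS, by rw [this]; exact hP⟩, this⟩

/-! ### Counting -/

/-- The set of monomials of a tuple of words. -/
def sofF {N n : ℕ} (f : Fin n → Fin 3 → Fin N) : Finset (Fin N → ℕ) :=
  Finset.univ.image fun k => monW (f k)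

lemma fibre_card {N n : ℕ} (S : Finset (Fin N → ℕ)) (hS : S.card = n) :
    (Finset.univ.filter fun f : Fin n → Fin 3 → Fin N => sofF f = S).card =
      n.factorial * ∏ a ∈ S, (wordsOf a).card := by
  have key : (Finset.univ.filter fun f : Fin n → Fin 3 → Fin N => sofF f = S) =
      (Finset.univ : Finset (Fin n ≃ S)).biUnion
        fun e => Fintype.piFinset fun k => wordsOf (e k : Fin N → ℕ) := by
    ext f
    simp only [Finset.mem_filter, Finset.mem_univ, true_and, Finset.mem_biUnion,
      Fintype.mem_piFinset, wordsOf]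
    constructor
    · intro h
      have hm : ∀ k, monW (f k) ∈ S := fun k => by
        rw [← h]; exact Finset.mem_image_of_mem _ (Finset.mem_univ k)
      let g : Fin n → S := fun k => ⟨monW (f k), hm k⟩
      have hg : Function.Bijective g := by
        rw [Fintype.bijective_iff_surjective_and_card]
        refine ⟨?_, by simp [hS]⟩
        rintro ⟨a, ha⟩
        rw [← h] at ha
        simp only [sofF, Finset.mem_image, Finset.mem_univ, true_and] at ha
        obtain ⟨k, hk⟩ := ha
        exact ⟨k, Subtype.ext hk⟩
      exact ⟨Equiv.ofBijective g hg, fun k => rfl⟩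
    · rintro ⟨e, he⟩
      ext a
      simp only [sofF, Finset.mem_image, Finset.mem_univ, true_and]
      constructor
      · rintro ⟨k, rfl⟩
        rw [he k]; exact (e k).2
      · intro ha
        exact ⟨e.symm ⟨a, ha⟩, by rw [he]; simp⟩
  rw [key, Finset.card_biUnion]
  · have : ∀ e : Fin n ≃ S, (Fintype.piFinset fun k => wordsOf (e k : Fin N → ℕ)).card =
        ∏ a ∈ S, (wordsOf a).card := by
      intro e
      rw [Fintype.card_piFinset, Equiv.prod_comp e (fun a : S => (wordsOf (a : Fin N → ℕ)).card)]
      exact Finset.prod_coe_sort S fun a => (wordsOf a).card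
    rw [Finset.sum_const_nat fun e _ => this e]
    congr 1
    have e0 : Fin n ≃ S := Fintype.equivOfCardEq (by simp [hS])
    rw [Finset.card_univ, Fintype.card_equiv e0]
    simp
  · intro e _ e' _ hne
    rw [Function.onFun, Finset.disjoint_left]
    intro f hf hf'
    simp only [Fintype.mem_piFinset, wordsOf, Finset.mem_filter, Finset.mem_univ, true_and]
      at hf hf'
    apply hne
    ext1 k
    apply Subtype.ext
    rw [← hf k, hf' k]

lemma count_lemma {N n : ℕ} (P : Finset (Fin N → ℕ) → Prop) (c : ℕ) (hc : 0 < c)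
    (h : ∀ S : Finset (Fin N → ℕ), CovS n S → P S → ∏ a ∈ S, (wordsOf a).card = c) :
    (Finset.univ.filter fun f : Fin n → Fin 3 → Fin N => CovS n (sofF f) ∧ P (sofF f)).card =
      Set.ncard {S : Finset (Fin N → ℕ) | CovS n S ∧ P S} * (n.factorial * c) := by
  set F := Finset.univ.filter fun f : Fin n → Fin 3 → Fin N => CovS n (sofF f) ∧ P (sofF f) with hF
  have hset : {S : Finset (Fin N → ℕ) | CovS n S ∧ P S} = ↑(F.image sofF) := by
    ext S
    simp only [Set.mem_ofPred_eq, Finset.coe_image, Set.mem_image, Finset.mem_coe, hF,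
      Finset.mem_filter, Finset.mem_univ, true_and]
    constructor
    · rintro ⟨hS, hP⟩
      have h1 := fibre_card S hS.1
      rw [h S hS hP] at h1
      have h2 : 0 < (Finset.univ.filter fun f : Fin n → Fin 3 → Fin N => sofF f = S).card := by
        rw [h1]; positivity
      obtain ⟨f, hf⟩ := Finset.card_pos.1 h2
      have hf' : sofF f = S := (Finset.mem_filter.1 hf).2
      exact ⟨f, by rw [hf']; exact ⟨hS, hP⟩, hf'⟩
    · rintro ⟨f, hf, rfl⟩
      exact hf
  rw [hset, Set.ncard_coe_finset, Finset.card_eq_sum_card_image sofF F]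
  apply Finset.sum_const_nat
  intro S hS
  rw [Finset.mem_image] at hS
  obtain ⟨f, hf, rfl⟩ := hS
  have hf' := (Finset.mem_filter.1 hf).2
  rw [← h _ hf'.1 hf'.2, ← fibre_card _ hf'.1.1]
  congr 1
  ext g
  simp only [hF, Finset.mem_filter, Finset.mem_univ, true_and]
  constructor
  · exact fun h => h.2
  · intro h
    rw [h]
    exact ⟨hf', rfl⟩

lemma cov_iff {N n : ℕ} (hN : N + 1 = 3 * n) (f : Fin n → Fin 3 → Fin N) :
    CovS n (sofF f) ↔ Function.Surjective (Function.uncurry f) := by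
  have h0 : (∀ i, ∃ a ∈ sofF f, a i ≠ 0) ↔ Function.Surjective (Function.uncurry f) := by
    simp only [sofF, Finset.mem_image, Finset.mem_univ, true_and, exists_exists_eq_and,
      monW_ne_zero, Function.Surjective, Prod.exists, Function.uncurry_apply_pair]
  constructor
  · intro h
    exact h0.1 h.2.2
  · intro h
    refine ⟨?_, ?_, h0.2 h⟩
    · rw [sofF, Finset.card_image_of_injective]
      · simp
      · intro k k' e
        by_contra hne
        have := excess_lemma hN Finset.univ (fun k => monW (f k)) (by simp)
          (fun k _ => deg_monW _) (monW (f k)) (by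
            intro i
            have h1 := sum_pair_le (fun k => monW (f k) i) (Finset.mem_univ k)
              (Finset.mem_univ k') hne
            have h2 := congrFun e i
            obtain ⟨⟨k0, j0⟩, hkj⟩ := h i
            have h3 := (monW_ne_zero (f k0) i).2 ⟨j0, hkj⟩
            have h4 := Finset.single_le_sum (f := fun k => monW (f k) i)
              (fun _ _ => Nat.zero_le _) (Finset.mem_univ k0)
            simp only at h1 h2 h4
            omega)
        rw [deg_monW] at this
        omega
    · intro a ha
      simp only [sofF, Finset.mem_image, Finset.mem_univ, true_and] at ha
      obtain ⟨k, rfl⟩ := ha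
      exact deg_monW _

lemma sq_iff {N n : ℕ} (f : Fin n → Fin 3 → Fin N) :
    SqS (sofF f) ↔ ∀ k, Function.Injective (f k) := by
  simp [SqS, sofF, ← monW_le_one]

lemma inj_off {α β : Type*} [Fintype α] [Fintype β] (hc : Fintype.card α = Fintype.card β + 1)
    {f : α → β} (hf : Function.Surjective f) {p q : α} (hpq : p ≠ q) (he : f p = f q) :
    Function.Bijective (fun x : {x // x ≠ q} => f x) := by
  rw [Fintype.bijective_iff_surjective_and_card]
  constructor
  · intro y
    obtain ⟨x, rfl⟩ := hf y
    by_cases hx : x = q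
    · exact ⟨⟨p, hpq⟩, by simp [hx, he]⟩
    · exact ⟨⟨x, hx⟩, rfl⟩
  · rw [Fintype.card_subtype_compl]
    simp [hc]

lemma coll_unique {α β : Type*} [Fintype α] [Fintype β]
    (hc : Fintype.card α = Fintype.card β + 1)
    {f : α → β} (hf : Function.Surjective f) {p q : α} (hpq : p ≠ q) (he : f p = f q)
    {x y : α} (hxy : x ≠ y) (he' : f x = f y) : (x = p ∧ y = q) ∨ (x = q ∧ y = p) := by
  have h1 : ∀ x y, x ≠ q → y ≠ q → f x = f y → x = y := fun x y hx hy h => by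
    have := (inj_off hc hf hpq he).1 (a₁ := ⟨x, hx⟩) (a₂ := ⟨y, hy⟩) h
    simpa using this
  have h2 : ∀ x y, x ≠ p → y ≠ p → f x = f y → x = y := fun x y hx hy h => by
    have := (inj_off hc hf hpq.symm he.symm).1 (a₁ := ⟨x, hx⟩) (a₂ := ⟨y, hy⟩) h
    simpa using this
  have a1 := h1 x y
  have a2 := h2 x y
  grind

lemma surj_count {α β : Type*} [Fintype α] [Fintype β]
    (hc : Fintype.card α = Fintype.card β + 1) {p q : α} (hpq : p ≠ q) :
    (Finset.univ.filter fun f : α → β => Function.Surjective f ∧ f p = f q).card =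
      (Fintype.card β).factorial := by
  have hcs : Fintype.card {x : α // x ≠ q} = Fintype.card β := by
    rw [Fintype.card_subtype_compl]
    simp [hc]
  have e0 : {x : α // x ≠ q} ≃ β := Fintype.equivOfCardEq hcs
  have h1 : Fintype.card ({x : α // x ≠ q} ≃ β) = (Fintype.card β).factorial := by
    rw [Fintype.card_equiv e0, hcs]
  rw [← h1, ← Finset.card_univ]
  refine Finset.card_bij (fun f hf => Equiv.ofBijective _
    (inj_off hc (Finset.mem_filter.1 hf).2.1 hpq (Finset.mem_filter.1 hf).2.2)) ?_ ?_ ?_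
  · intro f hf
    exact Finset.mem_univ _
  · intro f hf g hg e
    have hh : ∀ x, x ≠ q → f x = g x := fun x hx => by
      have := DFunLike.congr_fun e ⟨x, hx⟩
      simpa using this
    funext x
    by_cases hx : x = q
    · subst hx
      rw [← (Finset.mem_filter.1 hf).2.2, ← (Finset.mem_filter.1 hg).2.2]
      exact hh p hpq
    · exact hh x hx
  · intro e _
    refine ⟨fun x => if hx : x = q then e ⟨p, hpq⟩ else e ⟨x, hx⟩, ?_, ?_⟩
    · simp only [Finset.mem_filter, Finset.mem_univ, true_and]
      constructor
      · intro y
        refine ⟨e.symm y, ?_⟩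
        have := (e.symm y).2
        simp [this]
      · simp [hpq]
    · ext x
      have := x.2
      simp [this]

lemma surj_count' {N n : ℕ} (hN : N + 1 = 3 * n) {p q : Fin n × Fin 3} (hpq : p ≠ q) :
    (Finset.univ.filter fun f : Fin n → Fin 3 → Fin N =>
      Function.Surjective (Function.uncurry f) ∧ f p.1 p.2 = f q.1 q.2).card = N.factorial := by
  have h := surj_count (α := Fin n × Fin 3) (β := Fin N) (by simp; omega) hpq
  rw [Fintype.card_fin] at h
  rw [← h]
  refine Finset.card_equiv (Equiv.curry _ _ _).symm ?_
  intro f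
  simp [Function.uncurry]

/-- Double counting of collisions. -/
lemma double_count {N n : ℕ} (hN : N + 1 = 3 * n) (T : Finset ((Fin n × Fin 3) × (Fin n × Fin 3)))
    (Q : (Fin n → Fin 3 → Fin N) → Prop)
    (hT : ∀ t ∈ T, t.1 ≠ t.2) (hsymm : ∀ p q, (p, q) ∈ T → (q, p) ∈ T)
    (hQ : ∀ f, Function.Surjective (Function.uncurry f) →
      (Q f ↔ ∃ p q, (p, q) ∈ T ∧ f p.1 p.2 = f q.1 q.2)) :
    2 * (Finset.univ.filter fun f : Fin n → Fin 3 → Fin N =>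
      Function.Surjective (Function.uncurry f) ∧ Q f).card = T.card * N.factorial := by
  have h := Finset.sum_card_bipartiteAbove_eq_sum_card_bipartiteBelow
    (s := T) (t := Finset.univ.filter fun f : Fin n → Fin 3 → Fin N =>
      Function.Surjective (Function.uncurry f) ∧ Q f)
    (r := fun t f => f t.1.1 t.1.2 = f t.2.1 t.2.2)
  rw [Finset.sum_const_nat (m := N.factorial), Finset.sum_const_nat (m := 2)] at h
  · rw [h, mul_comm]
  · intro f hf
    simp only [Finset.mem_filter, Finset.mem_univ, true_and] at hf
    obtain ⟨p, q, hm, he⟩ := (hQ f hf.1).1 hf.2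
    have hpq : p ≠ q := hT _ hm
    have : Finset.bipartiteBelow (fun (t : (Fin n × Fin 3) × (Fin n × Fin 3))
        (f : Fin n → Fin 3 → Fin N) => f t.1.1 t.1.2 = f t.2.1 t.2.2) T f = {(p, q), (q, p)} := by
      ext ⟨x, y⟩
      simp only [Finset.mem_bipartiteBelow, Finset.mem_insert, Finset.mem_singleton,
        Prod.mk.injEq]
      constructor
      · rintro ⟨hxy, hexy⟩
        exact coll_unique (f := Function.uncurry f) (by simp; omega) hf.1 hpq he (hT _ hxy) hexy
      · rintro (⟨rfl, rfl⟩ | ⟨rfl, rfl⟩)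
        · exact ⟨hm, he⟩
        · exact ⟨hsymm _ _ hm, he.symm⟩
    rw [this, Finset.card_pair]
    simp [hpq]
  · rintro ⟨p, q⟩ hm
    rw [← surj_count' hN (hT _ hm)]
    congr 1
    ext f
    simp only [Finset.mem_bipartiteAbove, Finset.mem_filter, Finset.mem_univ, true_and]
    constructor
    · rintro ⟨⟨h1, _⟩, h2⟩; exact ⟨h1, h2⟩
    · rintro ⟨h1, h2⟩; exact ⟨⟨h1, (hQ f h1).2 ⟨p, q, hm, h2⟩⟩, h2⟩

lemma count_sq {N n : ℕ} (hN : N + 1 = 3 * n) :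
    2 * (Finset.univ.filter fun f : Fin n → Fin 3 → Fin N =>
      Function.Surjective (Function.uncurry f) ∧ ∀ k, Function.Injective (f k)).card
      = (3 * n) * (3 * (n - 1)) * N.factorial := by
  refine Eq.trans (by congr!) ((double_count hN (Finset.univ.filter fun t : (Fin n × Fin 3) × (Fin n × Fin 3) =>
    t.1.1 ≠ t.2.1) (fun f => ∀ k, Function.Injective (f k)) ?_ ?_ ?_).trans ?_)
  rotate_right
  · congr 1
    rw [Finset.card_filter, Fintype.sum_prod_type]
    rw [Finset.sum_const_nat (m := 3 * (n - 1))]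
    · rw [Finset.card_univ]; simp only [Fintype.card_prod, Fintype.card_fin]; ring
    · intro p _
      rw [← Finset.card_filter]
      have : (Finset.univ.filter fun q : Fin n × Fin 3 => p.1 ≠ q.1) =
          (Finset.univ.erase p.1) ×ˢ (Finset.univ : Finset (Fin 3)) := by
        ext q
        simp [eq_comm]
      rw [this, Finset.card_product, Finset.card_erase_of_mem (Finset.mem_univ _)]
      simp; ring
  · intro t ht e
    simp [e] at ht
  · intro p q h
    simpa [eq_comm] using h
  · intro f hf
    constructor
    · intro hi
      have : ¬ Function.Injective (Function.uncurry f) := by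
        intro hinj
        have := Fintype.card_le_of_injective _ hinj
        simp at this
        omega
      simp only [Function.Injective, not_forall] at this
      obtain ⟨p, q, he, hne⟩ := this
      refine ⟨p, q, ?_, he⟩
      simp only [Finset.mem_filter, Finset.mem_univ, true_and]
      intro h1
      apply hne
      refine Prod.ext h1 (hi p.1 ?_)
      rw [Function.uncurry, Function.uncurry, ← h1] at he
      exact he
    · rintro ⟨p, q, hm, he⟩ k j j' hj
      simp only [Finset.mem_filter, Finset.mem_univ, true_and] at hm
      by_contra hne
      have := coll_unique (f := Function.uncurry f) (by simp; omega) hf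
        (p := p) (q := q) (fun h => hm (by rw [h])) he (x := (k, j)) (y := (k, j'))
        (by simp [hne]) hj
      rcases this with ⟨rfl, rfl⟩ | ⟨rfl, rfl⟩ <;> simp at hm

lemma count_nsq {N n : ℕ} (hN : N + 1 = 3 * n) :
    2 * (Finset.univ.filter fun f : Fin n → Fin 3 → Fin N =>
      Function.Surjective (Function.uncurry f) ∧ ¬ ∀ k, Function.Injective (f k)).card
      = (3 * n) * 2 * N.factorial := by
  refine Eq.trans (by congr!) ((double_count hN (Finset.univ.filter fun t : (Fin n × Fin 3) × (Fin n × Fin 3) =>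
    t.1.1 = t.2.1 ∧ t.1.2 ≠ t.2.2) (fun f => ¬ ∀ k, Function.Injective (f k)) ?_ ?_ ?_).trans ?_)
  rotate_right
  · congr 1
    rw [Finset.card_filter, Fintype.sum_prod_type]
    rw [Finset.sum_const_nat (m := 2)]
    · rw [Finset.card_univ]; simp only [Fintype.card_prod, Fintype.card_fin]; ring
    · intro p _
      rw [← Finset.card_filter]
      have : (Finset.univ.filter fun q : Fin n × Fin 3 => p.1 = q.1 ∧ p.2 ≠ q.2) =
          {p.1} ×ˢ (Finset.univ.erase p.2) := by
        ext q
        simp only [Finset.mem_filter, Finset.mem_univ, true_and, Finset.mem_product,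
          Finset.mem_singleton, Finset.mem_erase, and_true]
        grind
      rw [this, Finset.card_product, Finset.card_erase_of_mem (Finset.mem_univ _)]
      simp
  · intro t ht e
    simp [e] at ht
  · intro p q h
    simpa [eq_comm] using h
  · intro f hf
    simp only [Function.Injective, not_forall]
    constructor
    · rintro ⟨k, j, j', he, hne⟩
      exact ⟨(k, j), (k, j'), by simp [hne], he⟩
    · rintro ⟨⟨k, j⟩, ⟨k', j'⟩, hm, he⟩
      simp only [Finset.mem_filter, Finset.mem_univ, true_and] at hm
      obtain ⟨rfl, hm⟩ := hm
      exact ⟨k, j, j', he, hm⟩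

lemma final_sq {N n : ℕ} (hN : N + 1 = 3 * n) :
    2 * (Set.ncard {S : Finset (Fin N → ℕ) | CovS n S ∧ SqS S} * (n.factorial * 6 ^ n)) =
      3 * (n - 1) * (3 * n).factorial := by
  rw [← count_lemma SqS (6 ^ n) (by positivity) fun S hS hq => (hS.sq_card hN hq).2]
  simp only [cov_iff hN, sq_iff]
  rw [count_sq hN, ← hN, Nat.factorial_succ]
  ring

lemma final_nsq {N n : ℕ} (hn : 1 ≤ n) (hN : N + 1 = 3 * n) :
    Set.ncard {S : Finset (Fin N → ℕ) | CovS n S ∧ ¬ SqS S} * (n.factorial * 6 ^ n) =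
      2 * (3 * n).factorial := by
  obtain ⟨m, rfl⟩ : ∃ m, n = m + 1 := ⟨n - 1, by omega⟩
  have h := count_lemma (N := N) (n := m + 1) (fun S => ¬ SqS S) (3 * 6 ^ m) (by positivity)
    fun S hS hq => by
      have := (hS.nsq_card hN hq).2
      rw [pow_succ] at this
      omega
  simp only [cov_iff hN, sq_iff] at h
  have h2 := count_nsq hN
  rw [h, ← hN] at h2
  rw [← hN, Nat.factorial_succ N, pow_succ]
  linarith

lemma div_fact (n : ℕ) : (n.factorial * 6 ^ n) * ((3 * n).factorial / (6 ^ n * n.factorial)) =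
    (3 * n).factorial := by
  rw [mul_comm n.factorial]
  apply Nat.mul_div_cancel'
  have := Nat.uniformBell_mul_eq n (n := 3) (by norm_num)
  rw [mul_comm 3 n, ← this]
  exact ⟨n.uniformBell 3, by simp [Nat.factorial]; ring⟩

/-- Proposition `prop:max2`: for `n ≥ 1`, every partition
`λ ⊆ ℕ^{3n−1}` with embedding dimension `3n−1` and socle consisting of exactly `n`
elements, all of degree 3, has Hilbert–Samuel function `(1, 3n−1, 3n, n)` or
`(1, 3n−1, 3n−1, n)`; the number `N₁` of those with `h_λ(2) = 3n` satisfies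
`2 N₁ = 3(n−1)·(3n)!/(6^n n!)`, and the number of those with `h_λ(2) = 3n−1`
equals `2·(3n)!/(6^n n!)`. -/
theorem stmt13 (n : ℕ) (hn : 1 ≤ n) :
    (∀ lam : Finset (Fin (3 * n - 1) → ℕ), IsPartitionFn lam → hsFn lam 1 = 3 * n - 1 →
      (socleFn lam).card = n → (∀ a ∈ socleFn lam, degFn a = 3) →
      (hsFn lam 0 = 1 ∧ (hsFn lam 2 = 3 * n ∨ hsFn lam 2 = 3 * n - 1) ∧ hsFn lam 3 = n ∧
        ∀ i, 3 < i → hsFn lam i = 0)) ∧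
    2 * Set.ncard {lam : Finset (Fin (3 * n - 1) → ℕ) | IsPartitionFn lam ∧
        hsFn lam 1 = 3 * n - 1 ∧ (socleFn lam).card = n ∧
        (∀ a ∈ socleFn lam, degFn a = 3) ∧ hsFn lam 2 = 3 * n} =
      3 * (n - 1) * ((3 * n).factorial / (6 ^ n * n.factorial)) ∧
    Set.ncard {lam : Finset (Fin (3 * n - 1) → ℕ) | IsPartitionFn lam ∧
        hsFn lam 1 = 3 * n - 1 ∧ (socleFn lam).card = n ∧
        (∀ a ∈ socleFn lam, degFn a = 3) ∧ hsFn lam 2 = 3 * n - 1} =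
      2 * ((3 * n).factorial / (6 ^ n * n.factorial)) := by

  have hN : (3 * n - 1) + 1 = 3 * n := by omega
  have hpos : 0 < n.factorial * 6 ^ n := by positivity
  have hdf := div_fact n
  refine ⟨?_, ?_, ?_⟩
  · intro lam h h1 h2 h3
    have hc := (good_iff h).2 ⟨h1, h2, h3⟩
    obtain ⟨a, b, c, d⟩ := good_hs hN h hc
    refine ⟨a, ?_, c, d⟩
    rw [b]
    split_ifs <;> simp
  · have hs : {lam : Finset (Fin (3 * n - 1) → ℕ) | IsPartitionFn lam ∧
        hsFn lam 1 = 3 * n - 1 ∧ (socleFn lam).card = n ∧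
        (∀ a ∈ socleFn lam, degFn a = 3) ∧ hsFn lam 2 = 3 * n} =
        {lam | IsPartitionFn lam ∧ CovS n (socleFn lam) ∧ SqS (socleFn lam)} := by
      ext lam
      simp only [Set.mem_ofPred_eq]
      constructor
      · rintro ⟨h, h1, h2, h3, h4⟩
        have hc := (good_iff h).2 ⟨h1, h2, h3⟩
        refine ⟨h, hc, ?_⟩
        by_contra hq
        have := (good_hs hN h hc).2.1
        rw [if_neg hq] at this
        omega
      · rintro ⟨h, hc, hq⟩
        obtain ⟨h1, h2, h3⟩ := (good_iff h).1 hc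
        have := (good_hs hN h hc).2.1
        rw [if_pos hq] at this
        exact ⟨h, h1, h2, h3, this⟩
    rw [hs, ncard_eq SqS]
    have hf := final_sq hN
    apply Nat.eq_of_mul_eq_mul_left hpos
    rw [← hdf] at hf
    linarith
  · have hs : {lam : Finset (Fin (3 * n - 1) → ℕ) | IsPartitionFn lam ∧
        hsFn lam 1 = 3 * n - 1 ∧ (socleFn lam).card = n ∧
        (∀ a ∈ socleFn lam, degFn a = 3) ∧ hsFn lam 2 = 3 * n - 1} =
        {lam | IsPartitionFn lam ∧ CovS n (socleFn lam) ∧ ¬ SqS (socleFn lam)} := by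
      ext lam
      simp only [Set.mem_ofPred_eq]
      constructor
      · rintro ⟨h, h1, h2, h3, h4⟩
        have hc := (good_iff h).2 ⟨h1, h2, h3⟩
        refine ⟨h, hc, ?_⟩
        intro hq
        have := (good_hs hN h hc).2.1
        rw [if_pos hq] at this
        omega
      · rintro ⟨h, hc, hq⟩
        obtain ⟨h1, h2, h3⟩ := (good_iff h).1 hc
        have := (good_hs hN h hc).2.1
        rw [if_neg hq] at this
        exact ⟨h, h1, h2, h3, this⟩
    rw [hs, ncard_eq fun S => ¬ SqS S]
    have hf := final_nsq hn hN
    apply Nat.eq_of_mul_eq_mul_left hpos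
    rw [← hdf] at hf
    linarith
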